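/- arXiv:2406.05444 — 3 statements merged into one kernel-verified Lean document; each statement's English description precedes it below -/
import Mathlib

section
/- Let M be a 3×3 real matrix that admits a spectral decomposition M = Pᵀ diag(λ₁, λ₂, 0) P, where P is an orthogonal 3×3 matrix (Pᵀ P = I) and λ₁ ≥ λ₂ ≥ 0 are real numbers. Let μ₃ be the 3-fold product of standard Gaussian measures on ℝ³ and μ₂ the 2-fold product of standard Gaussian measures on ℝ². Then the pushforward of μ₃ under the map x ↦ xᵀ M x equals the pushforward of μ₂ under the map (z₁, z₂) ↦ λ₁·z₁² + λ₂·z₂². In other words, the random variable xᵀMx with x standard Gaussian in ℝ³ has the same law as λ₁ζ₁² + λ₂ζ₂² with ζ₁, ζ₂ independent standard Gaussians. -/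
open Matrix MeasureTheory ProbabilityTheory

/-- The standard Gaussian measure is pushed forward to the standard Gaussian measure by every
matrix with orthonormal rows. -/
theorem map_mulVec_pi_gaussianReal {m n : Type*} [Fintype m] [Fintype n] [DecidableEq m]
    (A : Matrix m n ℝ) (hA : A * Aᵀ = 1) :
    (Measure.pi fun _ : n => gaussianReal 0 1).map (fun x => A *ᵥ x)
      = Measure.pi fun _ : m => gaussianReal 0 1 := by
  have hmeas : Measurable fun x : n → ℝ => A *ᵥ x :=
    (Continuous.matrix_mulVec continuous_const continuous_id).measurable
  apply (MeasurableEquiv.toLp 2 (m → ℝ)).map_measurableEquiv_injective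
  simp only [MeasurableEquiv.coe_toLp]
  rw [map_pi_eq_stdGaussian, Measure.map_map (WithLp.measurable_toLp 2 _) hmeas]
  have := Measure.isProbabilityMeasure_map (μ := Measure.pi fun _ : n => gaussianReal 0 1)
    ((WithLp.measurable_toLp 2 (m → ℝ)).comp hmeas).aemeasurable
  apply Measure.ext_of_charFun
  ext t
  have hinner (x : n → ℝ) : inner ℝ (WithLp.toLp 2 (A *ᵥ x)) t
      = inner ℝ (WithLp.toLp 2 x) (WithLp.toLp 2 (Aᵀ *ᵥ t.ofLp)) := by
    simp only [EuclideanSpace.inner_eq_star_dotProduct, star_trivial]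
    rw [dotProduct_mulVec, ← mulVec_transpose]
  have hnorm : ‖WithLp.toLp 2 (Aᵀ *ᵥ t.ofLp)‖ ^ 2 = ‖t‖ ^ 2 := by
    rw [← real_inner_self_eq_norm_sq, ← hinner, mulVec_mulVec, hA, one_mulVec,
      WithLp.toLp_ofLp, real_inner_self_eq_norm_sq]
  have hn := charFun_stdGaussian (WithLp.toLp 2 (Aᵀ *ᵥ t.ofLp))
  rw [← map_pi_eq_stdGaussian, charFun_apply,
    integral_map (WithLp.measurable_toLp 2 _).aemeasurable
      (Continuous.aestronglyMeasurable (by fun_prop))] at hn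
  rw [charFun_stdGaussian, charFun_apply,
    integral_map ((WithLp.measurable_toLp 2 (m → ℝ)).comp hmeas).aemeasurable
      (Continuous.aestronglyMeasurable (by fun_prop))]
  simp only [Function.comp_apply, hinner]
  rw [hn]
  exact_mod_cast congrArg (fun r : ℝ => Complex.exp (-(r : ℂ) / 2)) hnorm

/-- If `M = Pᵀ diag(λ₁, λ₂, 0) P` with `P` orthogonal and `λ₁ ≥ λ₂ ≥ 0`, then the law of
`x ↦ xᵀ M x` under the standard Gaussian on `ℝ³` equals the law of
`(ζ₁, ζ₂) ↦ λ₁ ζ₁² + λ₂ ζ₂²` under the standard Gaussian on `ℝ²`. -/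
theorem quadratic_form_gaussian_law_eq_hoyt_form
    (M P : Matrix (Fin 3) (Fin 3) ℝ) (l1 l2 : ℝ)
    (hP : Pᵀ * P = 1)
    (hM : M = Pᵀ * Matrix.diagonal ![l1, l2, 0] * P)
    (hl12 : l1 ≥ l2) (hl2 : l2 ≥ 0)
    (μ₃ : Measure (Fin 3 → ℝ)) (μ₂ : Measure (Fin 2 → ℝ))
    (hμ₃ : μ₃ = Measure.pi fun _ : Fin 3 => gaussianReal 0 1)
    (hμ₂ : μ₂ = Measure.pi fun _ : Fin 2 => gaussianReal 0 1) :
    μ₃.map (fun x => x ⬝ᵥ M *ᵥ x)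
      = μ₂.map (fun ζ => l1 * ζ 0 ^ 2 + l2 * ζ 1 ^ 2) := by
  have hmeas : Measurable fun x : Fin 3 → ℝ => P.submatrix ![0, 1] id *ᵥ x :=
    (Continuous.matrix_mulVec continuous_const continuous_id).measurable
  have hA : P.submatrix ![0, 1] id * (P.submatrix ![0, 1] id)ᵀ = 1 := by
    rw [transpose_submatrix, ← submatrix_mul P Pᵀ ![0, 1] id ![0, 1] Function.bijective_id,
      mul_eq_one_comm.mp hP]
    exact submatrix_one _ (by decide)
  have hquad (x : Fin 3 → ℝ) : x ⬝ᵥ M *ᵥ x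
      = l1 * (P.submatrix ![0, 1] id *ᵥ x) 0 ^ 2 + l2 * (P.submatrix ![0, 1] id *ᵥ x) 1 ^ 2 := by
    have h : x ⬝ᵥ M *ᵥ x = P *ᵥ x ⬝ᵥ diagonal ![l1, l2, 0] *ᵥ (P *ᵥ x) := by
      rw [hM, ← mulVec_mulVec, ← mulVec_mulVec, dotProduct_mulVec, vecMul_transpose]
    rw [h]
    simp [dotProduct, mulVec, Fin.sum_univ_three]
    ring
  rw [hμ₃, hμ₂, ← map_mulVec_pi_gaussianReal _ hA, Measure.map_map (by fun_prop) hmeas]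
  exact congrArg (Measure.map · _) (funext hquad)
end

section
/- (Lemma 2 of the paper.) Let H > 0 be a real number. The function f : ℝ² → ℝ defined by f(s) = log(√(‖s‖² + H²)) is convex on the closed Euclidean ball {s ∈ ℝ² : ‖s‖ ≤ H} centered at the origin. -/
theorem hasDerivAt_log_sqrt_sq_add_sq {H : ℝ} (hH : 0 < H) (r : ℝ) :
    HasDerivAt (fun r : ℝ => Real.log (Real.sqrt (r ^ 2 + H ^ 2))) (r / (r ^ 2 + H ^ 2)) r := by
  have hpos (x : ℝ) : 0 < x ^ 2 + H ^ 2 := by positivity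
  have h : HasDerivAt (fun r : ℝ => Real.log (r ^ 2 + H ^ 2) / 2)
      (2 * r / (r ^ 2 + H ^ 2) / 2) r := by
    simpa using ((((hasDerivAt_id r).pow 2).add_const (H ^ 2)).log (hpos r).ne').div_const 2
  convert h using 1
  · funext x
    exact Real.log_sqrt (hpos x).le
  · ring

theorem convexOn_log_sqrt_sq_add_sq {H : ℝ} (hH : 0 < H) :
    ConvexOn ℝ (Set.Icc 0 H) (fun r : ℝ => Real.log (Real.sqrt (r ^ 2 + H ^ 2))) := by
  have hderiv := hasDerivAt_log_sqrt_sq_add_sq hH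
  refine MonotoneOn.convexOn_of_deriv (convex_Icc 0 H)
    (fun x _ => (hderiv x).continuousAt.continuousWithinAt)
    (fun x _ => (hderiv x).differentiableAt.differentiableWithinAt) ?_
  rw [interior_Icc]
  intro a ha b hb hab
  rw [(hderiv a).deriv, (hderiv b).deriv, div_le_div_iff₀ (by positivity) (by positivity)]
  have hmul : a * b ≤ H * H := mul_le_mul ha.2.le hb.2.le hb.1.le hH.le
  nlinarith [mul_nonneg (sub_nonneg.2 hab) (sub_nonneg.2 hmul)]

theorem convexOn_log_sqrt_norm_sq_add_sq {E : Type*} [SeminormedAddCommGroup E] [NormedSpace ℝ E]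
    {H : ℝ} (hH : 0 < H) :
    ConvexOn ℝ (Metric.closedBall (0 : E) H)
      (fun s : E => Real.log (Real.sqrt (‖s‖ ^ 2 + H ^ 2))) := by
  refine ⟨convex_closedBall 0 H, fun x hx y hy a b ha hb hab => ?_⟩
  have hnorm : ‖a • x + b • y‖ ≤ a • ‖x‖ + b • ‖y‖ :=
    convexOn_univ_norm.2 (Set.mem_univ x) (Set.mem_univ y) ha hb hab
  refine le_trans ?_ ((convexOn_log_sqrt_sq_add_sq hH).2
    ⟨norm_nonneg x, mem_closedBall_zero_iff.1 hx⟩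
    ⟨norm_nonneg y, mem_closedBall_zero_iff.1 hy⟩ ha hb hab)
  exact Real.log_le_log (by positivity) (by gcongr)


/-- Lemma 2 of the paper: for `H > 0`, the function `s ↦ log √(‖s‖² + H²)` is convex on
the closed Euclidean ball of radius `H` centered at the origin in `ℝ²`. -/
theorem log_sqrt_norm_sq_add_convex (H : ℝ) (hH : 0 < H) :
    ConvexOn ℝ (Metric.closedBall (0 : EuclideanSpace ℝ (Fin 2)) H)
      (fun s : EuclideanSpace ℝ (Fin 2) => Real.log (Real.sqrt (‖s‖ ^ 2 + H ^ 2))) := by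
  exact convexOn_log_sqrt_norm_sq_add_sq hH
end

section
/- Let H > 0 and let s ∈ ℝ² be a nonzero column vector; write c = ‖s‖² + H² and define the symmetric 2×2 matrix M = (1/(2c²))·(c·I − 2·s sᵀ), where I is the 2×2 identity. Then: (i) M s = ((H² − ‖s‖²)/(2c²))·s; (ii) for every w ∈ ℝ² with ⟨w, s⟩ = 0, M w = (1/(2c))·w; (iii) M is positive semidefinite if and only if ‖s‖² ≤ H². -/
open Matrix
open scoped RealInnerProductSpace

/-- The coordinate vector underlying a point of `EuclideanSpace ℝ (Fin 2)`. -/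
noncomputable def toVec2 (x : EuclideanSpace ℝ (Fin 2)) : Fin 2 → ℝ :=
  (WithLp.equiv 2 (Fin 2 → ℝ)) x

lemma toVec2_dotProduct_toVec2 (x y : EuclideanSpace ℝ (Fin 2)) :
    toVec2 x ⬝ᵥ toVec2 y = ⟪x, y⟫ := by
  simp [toVec2, dotProduct, PiLp.inner_apply, mul_comm]

lemma smul_smul_one_sub_vecMulVec_mulVec {n : Type*} [Fintype n] [DecidableEq n]
    (a c : ℝ) (u v : n → ℝ) :
    (a • (c • (1 : Matrix n n ℝ) - 2 • vecMulVec u u)) *ᵥ v =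
      a • (c • v - (2 * (u ⬝ᵥ v)) • u) := by
  ext i
  simp only [smul_mulVec, sub_mulVec, one_mulVec, vecMulVec_mulVec, Pi.smul_apply, Pi.sub_apply,
    smul_eq_mul, MulOpposite.smul_eq_mul_unop, MulOpposite.unop_op, two_nsmul, add_mulVec,
    Pi.add_apply]
  ring

lemma isHermitian_smul_smul_one_sub_vecMulVec {n : Type*} [DecidableEq n]
    (a c : ℝ) (u : n → ℝ) :
    (a • (c • (1 : Matrix n n ℝ) - 2 • vecMulVec u u)).IsHermitian := by
  ext i j
  simp [vecMulVec_apply, one_apply, eq_comm, mul_comm]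

lemma posSemidef_smul_smul_one_sub_vecMulVec_iff {n : Type*} [Fintype n] [DecidableEq n]
    {a c : ℝ} (ha : 0 < a) {u : n → ℝ} (hu : 0 < u ⬝ᵥ u) :
    (a • (c • (1 : Matrix n n ℝ) - 2 • vecMulVec u u)).PosSemidef ↔ 2 * (u ⬝ᵥ u) ≤ c := by
  have key (x : n → ℝ) :
      star x ⬝ᵥ ((a • (c • (1 : Matrix n n ℝ) - 2 • vecMulVec u u)) *ᵥ x) =
        a * (c * (x ⬝ᵥ x) - 2 * (u ⬝ᵥ x) ^ 2) := by
    rw [smul_smul_one_sub_vecMulVec_mulVec, star_trivial, dotProduct_smul, dotProduct_sub,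
      dotProduct_smul, dotProduct_smul, dotProduct_comm x u]
    simp only [smul_eq_mul]
    ring
  constructor
  · intro h
    have h0 := h.dotProduct_mulVec_nonneg u
    rw [key] at h0
    have h1 : 0 ≤ (c - 2 * (u ⬝ᵥ u)) * (u ⬝ᵥ u) := by
      have := nonneg_of_mul_nonneg_right h0 ha
      linarith
    linarith [nonneg_of_mul_nonneg_left h1 hu]
  · intro h
    refine .of_dotProduct_mulVec_nonneg (isHermitian_smul_smul_one_sub_vecMulVec a c u) fun x => ?_
    rw [key]
    have cauchy : (u ⬝ᵥ x) ^ 2 ≤ (u ⬝ᵥ u) * (x ⬝ᵥ x) := by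
      simpa [dotProduct, sq] using Finset.sum_mul_sq_le_sq_mul_sq Finset.univ u x
    have hx : 0 ≤ x ⬝ᵥ x := by simpa using dotProduct_star_self_nonneg x
    refine mul_nonneg ha.le ?_
    linarith [mul_le_mul_of_nonneg_right h hx]

/-- For `H > 0` and nonzero `s ∈ ℝ²`, let `c = ‖s‖² + H²` and
`M = (1/(2c²)) (c I − 2 s sᵀ)`. Then `M s = ((H² − ‖s‖²)/(2c²)) s`, `M w = (1/(2c)) w`
for every `w ⊥ s`, and `M` is positive semidefinite iff `‖s‖² ≤ H²`. -/
theorem hessian_log_distance_eigen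
    (H : ℝ) (hH : 0 < H)
    (s : EuclideanSpace ℝ (Fin 2)) (hs : s ≠ 0)
    (c : ℝ) (hc : c = ‖s‖ ^ 2 + H ^ 2)
    (M : Matrix (Fin 2) (Fin 2) ℝ)
    (hM : M = (1 / (2 * c ^ 2)) •
      (c • (1 : Matrix (Fin 2) (Fin 2) ℝ) - 2 • vecMulVec (toVec2 s) (toVec2 s))) :
    M *ᵥ toVec2 s = ((H ^ 2 - ‖s‖ ^ 2) / (2 * c ^ 2)) • toVec2 s ∧
    (∀ w : EuclideanSpace ℝ (Fin 2), ⟪w, s⟫ = 0 →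
      M *ᵥ toVec2 w = (1 / (2 * c)) • toVec2 w) ∧
    (M.PosSemidef ↔ ‖s‖ ^ 2 ≤ H ^ 2) := by
  have hnorm : toVec2 s ⬝ᵥ toVec2 s = ‖s‖ ^ 2 := by
    rw [toVec2_dotProduct_toVec2, real_inner_self_eq_norm_sq]
  have hs0 : 0 < ‖s‖ ^ 2 := by positivity
  have hc0 : 0 < c := by rw [hc]; positivity
  subst hM
  refine ⟨?_, fun w hw => ?_, ?_⟩
  · rw [smul_smul_one_sub_vecMulVec_mulVec, hnorm, ← sub_smul, smul_smul]
    congr 1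
    rw [hc]
    ring
  · rw [smul_smul_one_sub_vecMulVec_mulVec, toVec2_dotProduct_toVec2, real_inner_comm, hw,
      mul_zero, zero_smul, sub_zero, smul_smul]
    congr 1
    field_simp
  · rw [posSemidef_smul_smul_one_sub_vecMulVec_iff (by positivity) (hnorm ▸ hs0), hnorm, hc]
    constructor <;> intro h <;> linarith
end
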